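/- Consider the constrained closed-loop system ẋ = B·sat(−Bᵀ∇H(x) − x_c; u⁻, u⁺), ẋ_c = Bᵀ∇H(x), where B is the incidence matrix of a strongly connected directed graph G with n vertices and m edges, H : ℝⁿ → ℝ is twice continuously differentiable with everywhere positive definite Hessian, and the orientation is compatible with the constraints: 0 ≤ u⁻ᵢ < u⁺ᵢ and u⁺ᵢ > 0 for all i. Let T = (C₁,…,C_k) be a minimal family of directed cycles of G covering every edge, let Tᵢ be the number of cycles of T containing edge i, and let the augmented graph G̃(T) be obtained by splitting each edge i into Tᵢ parallel edges with the same orientation, carrying constraint intervals [u⁻ᵢ, b₂], [0, b₃ − b₂], …, [0, u⁺ᵢ − b_{Tᵢ}] for some chosen u⁻ᵢ < b₂ < ⋯ < b_{Tᵢ} < u⁺ᵢ, so that G̃(T) is balanced and is covered by a family T̃ = (C̃₁,…,C̃_k) of pairwise edge-disjoint directed cycles. If there exists such a splitting of the edges for which, for every cycle C̃ⱼ (j = 1,…,k), the intersection of the constraint intervals of all edges of C̃ⱼ has non-empty interior, then every trajectory of the system converges to the set E_tot = { (x, x_c) : ∇H(x) = α𝟙ₙ for some α ∈ ℝ, and B·sat(−x_c;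 u⁻, u⁺) = 0 }. -/

import Mathlib

open Matrix Filter

/-- The scalar saturation function: sat(x; a, b) = a if x ≤ a, x if a < x < b,
and b if x ≥ b. -/
noncomputable def sat (x a b : ℝ) : ℝ := if x ≤ a then a else if x < b then x else b

/-- The multidimensional saturation function, defined componentwise. -/
noncomputable def satVec {m : ℕ} (x a b : Fin m → ℝ) : Fin m → ℝ :=
  fun i => sat (x i) (a i) (b i)

/-- A family of `k` directed cycles in a directed graph with vertices `V`, edges `E`
and tail/head maps `tl`, `hd`: the `j`-th cycle has length `len j + 1`, visits the
pairwise distinct vertices `v j 0, v j 1, …` through the pairwise distinct edges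
`f j 0, f j 1, …`, all traversed in their given direction. -/
def IsDirCycleFamily {V E : Type*} (tl hd : E → V) {k : ℕ} (len : Fin k → ℕ)
    (v : (j : Fin k) → Fin (len j + 1) → V)
    (f : (j : Fin k) → Fin (len j + 1) → E) : Prop :=
  (∀ j, Function.Injective (v j)) ∧ (∀ j, Function.Injective (f j)) ∧
  ∀ j i, tl (f j i) = v j i ∧ hd (f j i) = v j (i + 1)

section aux
open Topology

lemma sat_mem {a b : ℝ} (h : a < b) (x : ℝ) : a ≤ sat x a b ∧ sat x a b ≤ b := by
  unfold sat; split_ifs <;> constructor <;> linarith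

lemma sat_eq {a b : ℝ} (h : a < b) (x : ℝ) : sat x a b = max a (min x b) := by
  unfold sat; split_ifs with h1 h2
  · rw [min_eq_left (by linarith), max_eq_left h1]
  · rw [min_eq_left (by linarith), max_eq_right (by linarith)]
  · rw [min_eq_right (by linarith), max_eq_right (by linarith)]

lemma sat_self {a b x : ℝ} (h1 : a < x) (h2 : x < b) : sat x a b = x := by
  unfold sat; split_ifs <;> linarith

lemma sat_cont {a b : ℝ} (h : a < b) : Continuous (fun x => sat x a b) := by
  simp_rw [sat_eq h]; fun_prop

/-- `y Δ ≤ -Δ²` -/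
lemma sat_diss {a b : ℝ} (h : a < b) (y s : ℝ) :
    y * (sat (-y - s) a b - sat (-s) a b) ≤ -(sat (-y - s) a b - sat (-s) a b) ^ 2 := by
  unfold sat; split_ifs <;> nlinarith

lemma hasDerivAt_of_quad {f : ℝ → ℝ} {f' x C : ℝ} 
    (hq : ∀ y, |f y - f x - f' * (y - x)| ≤ C * (y - x) ^ 2) : HasDerivAt f f' x := by
  rw [hasDerivAt_iff_isLittleO]
  have h1 : (fun y => f y - f x - (y - x) • f') =O[𝓝 x] (fun y => (y - x) ^ 2) := by
    refine Asymptotics.IsBigO.of_bound C (Eventually.of_forall fun y => ?_)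
    rw [Real.norm_eq_abs, Real.norm_eq_abs, abs_of_nonneg (sq_nonneg (y - x)), smul_eq_mul,
      mul_comm (y - x)]
    exact hq y
  refine h1.trans_isLittleO ?_
  have := (Asymptotics.isLittleO_pow_id (𝕜 := ℝ) (n := 2) (by norm_num)).comp_tendsto
    (k := fun y => y - x) (l' := 𝓝 x) (by
      have : Tendsto (fun y => y - x) (𝓝 x) (𝓝 (x - x)) := by
        apply Continuous.tendsto (by fun_prop)
      simpa using this)
  simpa [Function.comp_def] using this

/-- antiderivative of `sat` -/
noncomputable def Qf (a b r : ℝ) : ℝ := r * sat r a b - sat r a b ^ 2 / 2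

lemma Qf_ge {a b : ℝ} (_h : a < b) (r w : ℝ) (h1 : a ≤ w) (h2 : w ≤ b) :
    r * w - w ^ 2 / 2 ≤ Qf a b r := by
  unfold Qf sat; split_ifs <;> nlinarith [sq_nonneg (r - w)]

lemma Qf_deriv {a b : ℝ} (h : a < b) (r : ℝ) : HasDerivAt (Qf a b) (sat r a b) r := by
  apply hasDerivAt_of_quad (C := 1)
  intro y
  have h1 := Qf_ge h y (sat r a b) (sat_mem h r).1 (sat_mem h r).2
  have h2 := Qf_ge h r (sat y a b) (sat_mem h y).1 (sat_mem h y).2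
  have h3 : (sat y a b - sat r a b) * (y - r) ≤ (y - r) ^ 2 := by
    unfold sat; split_ifs <;> nlinarith
  have e1 : Qf a b r = r * sat r a b - sat r a b ^ 2 / 2 := rfl
  have e2 : Qf a b y = y * sat y a b - sat y a b ^ 2 / 2 := rfl
  rw [abs_le]; constructor <;> nlinarith [sq_nonneg (y - r)]

noncomputable def Th (a b w : ℝ) : ℝ := (b - a) * (w - a) ^ 2 / 2 - (w - a) ^ 3 / 3

lemma Th_mono {a b w1 w2 : ℝ} (h1 : a ≤ w1) (h12 : w1 ≤ w2) (h2 : w2 ≤ b) :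
    (w2 - w1) ^ 3 / 6 ≤ Th a b w2 - Th a b w1 := by
  unfold Th
  obtain ⟨u, rfl⟩ : ∃ u, w1 = a + u := ⟨w1 - a, by ring⟩
  obtain ⟨d, rfl⟩ : ∃ d, w2 = a + u + d := ⟨w2 - a - u, by ring⟩
  obtain ⟨c, rfl⟩ : ∃ c, b = a + u + d + c := ⟨b - a - u - d, by ring⟩
  have hu : 0 ≤ u := by linarith
  have hd : 0 ≤ d := by linarith
  have hc : 0 ≤ c := by linarith
  have : Th a (a+u+d+c) (a+u+d) - Th a (a+u+d+c) (a+u) - d^3/6 =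
     c * d * (2 * u + d) / 2 + d * (d * 3 * u)/6 := by
    unfold Th; ring
  have h0 : 0 ≤ c * d * (2 * u + d) / 2 + d * (d * 3 * u)/6 := by positivity
  unfold Th at this
  have e : (a + u + d - (a + u)) = d := by ring
  rw [e]
  linarith

lemma Th_abs {a b w1 w2 : ℝ} (h1 : a ≤ w1) (h1' : w1 ≤ b) (h2 : w2 ≤ b) (h2' : a ≤ w2) :
    |w2 - w1| ^ 3 / 6 ≤ |Th a b w2 - Th a b w1| := by
  rcases le_total w1 w2 with h | h
  · rw [abs_of_nonneg (sub_nonneg.2 h)]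
    exact (Th_mono h1 h h2).trans (le_abs_self _)
  · rw [abs_sub_comm, abs_of_nonneg (sub_nonneg.2 h), abs_sub_comm]
    exact (Th_mono h2' h h1').trans (le_abs_self _)

lemma Th_sat_deriv {a b : ℝ} (h : a < b) (r : ℝ) :
    HasDerivAt (fun r => Th a b (sat r a b)) ((sat r a b - a) * (b - sat r a b)) r := by
  rcases lt_trichotomy r a with h1 | h1 | h1
  · have : (fun r => Th a b (sat r a b)) =ᶠ[𝓝 r] fun _ => Th a b a := by
      filter_upwards [gt_mem_nhds h1] with s hs
      simp only [sat, if_pos hs.le]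
    have e : sat r a b = a := by simp only [sat, if_pos h1.le]
    rw [e]; simpa using (hasDerivAt_const r (Th a b a)).congr_of_eventuallyEq this
  · subst h1
    have e : sat r r b = r := by simp [sat]
    rw [e]
    apply hasDerivAt_of_quad (C := b - r)
    intro y
    rw [e]
    have m := sat_mem h y
    have hh : (sat y r b - r)^2 ≤ (y - r)^2 := by
      unfold sat; split_ifs <;> nlinarith
    have : Th r b (sat y r b) - Th r b r - (r - r) * (b - r) * (y - r) =
      (sat y r b - r)^2 * ((b - r) / 2 - (sat y r b - r)/3) := by unfold Th; ring
    rw [this, abs_mul, abs_of_nonneg (sq_nonneg _), mul_comm]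
    apply mul_le_mul _ hh (sq_nonneg _) (by linarith)
    rw [abs_le]; constructor <;> linarith
  rcases lt_trichotomy r b with h2 | h2 | h2
  · have : (fun r => Th a b (sat r a b)) =ᶠ[𝓝 r] fun s => Th a b s := by
      filter_upwards [lt_mem_nhds h1, gt_mem_nhds h2] with s hs hs2
      simp only [sat_self hs hs2]
    rw [sat_self h1 h2]
    refine HasDerivAt.congr_of_eventuallyEq ?_ this
    unfold Th
    have h0 : HasDerivAt (fun s => s - a) 1 r := (hasDerivAt_id r).sub_const a
    have h3 := (((h0.fun_pow 2).const_mul (b - a)).div_const 2).fun_sub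
      ((h0.fun_pow 3).div_const 3)
    refine h3.congr_deriv ?_
    norm_num; ring
  · subst h2
    have e : sat r a r = r := by unfold sat; split_ifs <;> linarith
    rw [e]
    apply hasDerivAt_of_quad (C := r - a)
    intro y
    rw [e]
    have m := sat_mem h y
    have hh : (sat y a r - r)^2 ≤ (y - r)^2 := by
      unfold sat; split_ifs <;> nlinarith
    have : Th a r (sat y a r) - Th a r r - (r - a) * (r - r) * (y - r) =
      (sat y a r - r)^2 * (-(r - a) / 2 - (sat y a r - r)/3) := by unfold Th; ring
    rw [this, abs_mul, abs_of_nonneg (sq_nonneg _), mul_comm]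
    apply mul_le_mul _ hh (sq_nonneg _) (by linarith)
    rw [abs_le]; constructor <;> linarith
  · have : (fun r => Th a b (sat r a b)) =ᶠ[𝓝 r] fun _ => Th a b b := by
      filter_upwards [lt_mem_nhds h2] with s hs
      simp only [sat, if_neg (not_le.2 (h.trans hs)), if_neg (not_lt.2 hs.le)]
    have e : sat r a b = b := by
      simp only [sat, if_neg (not_le.2 (h.trans h2)), if_neg (not_lt.2 h2.le)]
    rw [e]; simpa using (hasDerivAt_const r (Th a b b)).congr_of_eventuallyEq this

lemma key_bound {a b : ℝ} (h : a < b) (y s : ℝ) :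
    |y * ((sat (-s) a b - a) * (b - sat (-s) a b))| ≤
      (b - a) * |y * (sat (-y - s) a b - sat (-s) a b)| +
      (b - a) ^ 2 * √|y * (sat (-y - s) a b - sat (-s) a b)| := by
  have hnn : 0 ≤ (b - a) * |y * (sat (-y - s) a b - sat (-s) a b)| +
      (b - a) ^ 2 * √|y * (sat (-y - s) a b - sat (-s) a b)| := by
    have : 0 < b - a := by linarith
    positivity
  set D := sat (-y - s) a b - sat (-s) a b with hD
  by_cases h1 : -s ≤ a
  · have : sat (-s) a b = a := by simp [sat, h1]
    rw [this]; simpa using hnn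
  by_cases h2 : b ≤ -s
  · have : sat (-s) a b = b := by simp [sat, h1, not_lt.2 h2]
    rw [this]; simpa using hnn
  push Not at h1 h2
  have e : sat (-s) a b = -s := sat_self h1 h2
  rw [e] at hD ⊢
  have hyD : |y * D| = |y| * |D| := abs_mul _ _
  have hp1 : 0 < -s - a := by linarith
  have hp2 : 0 < b - -s := by linarith
  -- either |D| = |y| or |D| = distance to bound
  have hcase : |D| = |y| ∨ |D| = -s - a ∨ |D| = b - -s := by
    rw [hD]; unfold sat; split_ifs with g1 g2
    · right; left; rw [abs_of_neg (by linarith)]; ring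
    · left; rw [← abs_neg]; congr 1; ring
    · right; right; rw [abs_of_pos (by linarith)]
  rw [abs_mul, abs_of_pos (mul_pos hp1 hp2)]
  have hy := abs_nonneg y
  rcases hcase with hc | hc | hc
  · have : √|y * D| = |y| := by rw [hyD, hc]; exact Real.sqrt_mul_self hy
    rw [this]
    have h3 : (-s - a) * (b - -s) ≤ (b - a)^2 := by nlinarith
    have h4 := mul_le_mul_of_nonneg_left h3 hy
    have : 0 ≤ (b - a) * |y * D| := mul_nonneg (by linarith) (abs_nonneg _)
    linarith
  · have h5 : 0 ≤ (b - a)^2 * √|y * D| := by positivity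
    rw [hyD, hc] at *
    have : |y| * ((-s - a) * (b - -s)) ≤ (b - a) * (|y| * (-s - a)) := by
      nlinarith [mul_nonneg hy hp1.le]
    linarith
  · have h5 : 0 ≤ (b - a)^2 * √|y * D| := by positivity
    rw [hyD, hc] at *
    have : |y| * ((-s - a) * (b - -s)) ≤ (b - a) * (|y| * (b - -s)) := by
      nlinarith [mul_nonneg hy hp2.le]
    linarith

end aux

section aux2
open Topology

/-- slowly varying at infinity -/
def SV {E : Type*} [NormedAddCommGroup E] (f : ℝ → E) : Prop :=
  ∀ L > 0, ∀ ε > 0, ∃ T ≥ (0:ℝ), ∀ t ≥ T, ∀ s, 0 ≤ s → s ≤ L → ‖f (t + s) - f t‖ ≤ ε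

lemma SV.congr0 {E : Type*} [NormedAddCommGroup E] {f g : ℝ → E} (hg : SV g)
    (h : Tendsto (fun t => f t - g t) atTop (𝓝 0)) : SV f := by
  intro L hL ε hε
  obtain ⟨T, hT, h1⟩ := hg L hL (ε/3) (by linarith)
  obtain ⟨T2, h2⟩ := (Metric.tendsto_atTop.1 h) (ε/3) (by linarith)
  refine ⟨max T T2, le_max_of_le_left hT, fun t ht s hs hsL => ?_⟩
  have a1 := h1 t ((le_max_left _ _).trans ht) s hs hsL
  have a2 := h2 t ((le_max_right _ _).trans ht)
  have a3 := h2 (t + s) (by have := (le_max_right T T2).trans ht; linarith)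
  rw [dist_zero_right] at a2 a3
  have : f (t + s) - f t = (f (t+s) - g (t+s)) + (g (t+s) - g t) - (f t - g t) := by abel
  rw [this]
  have b1 := norm_sub_le ((f (t+s) - g (t+s)) + (g (t+s) - g t)) (f t - g t)
  have b2 := norm_add_le (f (t+s) - g (t+s)) (g (t+s) - g t)
  linarith

lemma SV.comp {E F : Type*} [NormedAddCommGroup E] [NormedAddCommGroup F] {f : ℝ → E}
    (hf : SV f) {K : Set E} (hK : IsCompact K) (hfK : ∀ t, 0 ≤ t → f t ∈ K) {Φ : E → F}
    (hΦ : Continuous Φ) : SV (fun t => Φ (f t)) := by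
  intro L hL ε hε
  have hu := hK.uniformContinuousOn_of_continuous hΦ.continuousOn
  obtain ⟨δ, hδ, h⟩ := Metric.uniformContinuousOn_iff.1 hu ε hε
  obtain ⟨T, hT, h1⟩ := hf L hL (δ/2) (by linarith)
  refine ⟨T, hT, fun t ht s hs hsL => ?_⟩
  have := h (f (t+s)) (hfK _ (by linarith)) (f t) (hfK _ (by linarith)) (by
    rw [dist_eq_norm]; linarith [h1 t ht s hs hsL])
  rw [dist_eq_norm] at this
  exact this.le

lemma SV.pi {ι : Type*} [Fintype ι] {f : ℝ → ι → ℝ} (h : ∀ i, SV (fun t => f t i)) : SV f := by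
  intro L hL ε hε
  choose T hT hh using fun i => h i L hL ε hε
  refine ⟨∑ i, T i, Finset.sum_nonneg fun i _ => hT i, fun t ht s hs hsL => ?_⟩
  rw [pi_norm_le_iff_of_nonneg hε.le]
  intro i
  exact hh i t ((Finset.single_le_sum (fun i _ => hT i) (Finset.mem_univ i)).trans ht) s hs hsL

lemma SV.of_deriv {E : Type*} [NormedAddCommGroup E] [NormedSpace ℝ E] {f f' : ℝ → E}
    (hd : ∀ t, 0 ≤ t → HasDerivAt f (f' t) t) (h0 : Tendsto f' atTop (𝓝 0)) : SV f := by
  intro L hL ε hε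
  obtain ⟨T, hT⟩ := (Metric.tendsto_atTop.1 h0) (ε/L) (by positivity)
  refine ⟨max T 0, le_max_right _ _, fun t ht s hs hsL => ?_⟩
  have hb := Convex.norm_image_sub_le_of_norm_hasDerivWithin_le (f := f) (f' := f') (C := ε / L)
    (s := Set.Ici (max T 0)) (x := t) (y := t + s) 
    (fun x hx => (hd x ((le_max_right _ _).trans hx)).hasDerivWithinAt)
    (fun x hx => by
      have := hT x ((le_max_left _ _).trans hx)
      rw [dist_zero_right] at this; exact this.le)
    (convex_Ici _) ht (by simp only [Set.mem_Ici]; linarith)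
  refine hb.trans ?_
  rw [add_sub_cancel_left, Real.norm_of_nonneg hs, div_mul_eq_mul_div, div_le_iff₀ hL]
  exact mul_le_mul_of_nonneg_left hsL hε.le

/-- bounded function with slowly varying derivative has derivative tending to 0 -/
lemma SV.tendsto_zero {f f' : ℝ → ℝ} {M : ℝ}
    (hd : ∀ t, 0 ≤ t → HasDerivAt f (f' t) t) (hM : ∀ t, 0 ≤ t → |f t| ≤ M)
    (h : SV f') : Tendsto f' atTop (𝓝 0) := by
  rw [Metric.tendsto_atTop]
  intro ε hε
  have hM0 : 0 ≤ M := (abs_nonneg _).trans (hM 0 le_rfl)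
  set L := 8 * (M + 1) / ε with hL
  have hLp : 0 < L := by positivity
  obtain ⟨T, hT, h1⟩ := h L hLp (ε/2) (by linarith)
  refine ⟨T, fun t ht => ?_⟩
  obtain ⟨c, hc, hc2⟩ := exists_hasDerivAt_eq_slope f f' (a := t) (b := t + L) (by linarith)
    (fun x hx => (hd x (by linarith [hx.1])).continuousAt.continuousWithinAt)
    (fun x hx => hd x (by linarith [hx.1]))
  have h2 := h1 t ht (c - t) (by linarith [hc.1]) (by linarith [hc.2])
  rw [add_sub_cancel, Real.norm_eq_abs] at h2
  have h3 : |f' c| ≤ ε / 4 := by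
    rw [hc2, add_sub_cancel_left, abs_div, abs_of_pos hLp, div_le_iff₀ hLp]
    have : ε / 4 * L = 2 * (M + 1) := by rw [hL]; field_simp; ring
    rw [this]
    have a1 := abs_le.1 (hM t (by linarith))
    have a2 := abs_le.1 (hM (t + L) (by linarith))
    rw [abs_le]; constructor <;> linarith
  rw [dist_zero_right, Real.norm_eq_abs]
  have a1 := abs_le.1 h2
  have a2 := abs_le.1 h3
  rw [abs_lt]; constructor <;> linarith

/-- Barbalat for a nonincreasing bounded below function -/
lemma barbalat {f f' : ℝ → ℝ} {M : ℝ}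
    (hd : ∀ t, 0 ≤ t → HasDerivAt f (f' t) t) (hM : ∀ t, 0 ≤ t → M ≤ f t)
    (hneg : ∀ t, 0 ≤ t → f' t ≤ 0)
    (hu : ∀ ε > 0, ∃ δ > 0, ∀ t s, 0 ≤ t → t ≤ s → s ≤ t + δ → |f' s - f' t| ≤ ε) :
    Tendsto f' atTop (𝓝 0) := by
  have hanti : AntitoneOn f (Set.Ici 0) := by
    apply antitoneOn_of_hasDerivWithinAt_nonpos (f' := f') (convex_Ici 0)
    · exact fun x hx => (hd x hx).continuousAt.continuousWithinAt
    · intro x hx; rw [interior_Ici] at hx; exact (hd x (le_of_lt hx)).hasDerivWithinAt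
    · intro x hx; rw [interior_Ici] at hx; exact hneg x (le_of_lt hx)
  obtain ⟨l, hl⟩ : ∃ l, Tendsto f atTop (𝓝 l) := by
    have ha : Antitone (fun t => f (max t 0)) := fun s t hst =>
      hanti (Set.mem_Ici.2 (le_max_right _ _)) (Set.mem_Ici.2 (le_max_right _ _)) (max_le_max_right _ hst)
    have hb : BddBelow (Set.range fun t => f (max t 0)) :=
      ⟨M, by rintro _ ⟨t, rfl⟩; exact hM _ (le_max_right _ _)⟩
    refine ⟨_, (tendsto_atTop_ciInf ha hb).congr' ?_⟩
    filter_upwards [eventually_ge_atTop 0] with t ht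
    rw [max_eq_left ht]
  rw [Metric.tendsto_atTop]
  intro ε hε
  obtain ⟨δ, hδ, h⟩ := hu (ε/2) (by linarith)
  obtain ⟨T, hT⟩ := (Metric.tendsto_atTop.1 hl) (ε / 8 * δ) (by positivity)
  refine ⟨max T 0, fun t ht => ?_⟩
  have ht0 : 0 ≤ t := (le_max_right _ _).trans ht
  have htT : T ≤ t := (le_max_left _ _).trans ht
  obtain ⟨c, hc, hc2⟩ := exists_hasDerivAt_eq_slope f f' (a := t) (b := t + δ) (by linarith)
    (fun x hx => (hd x (by linarith [hx.1])).continuousAt.continuousWithinAt)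
    (fun x hx => hd x (by linarith [hx.1]))
  have h2 := h t c ht0 hc.1.le hc.2.le
  have h3 : |f' c| ≤ ε / 4 := by
    rw [hc2, add_sub_cancel_left, abs_div, abs_of_pos hδ, div_le_iff₀ hδ]
    have a1 := hT t htT
    have a2 := hT (t + δ) (by linarith)
    rw [Real.dist_eq, abs_lt] at a1 a2
    rw [abs_le]; constructor <;> linarith
  rw [dist_zero_right, Real.norm_eq_abs]
  have a1 := abs_le.1 h2
  have a2 := abs_le.1 h3
  rw [abs_lt]; constructor <;> linarith

lemma infDist_tendsto {E F : Type*} [NormedAddCommGroup E] [NormedAddCommGroup F]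
    {z : ℝ → E} {K : Set E} (hK : IsCompact K) (hz : ∀ t, 0 ≤ t → z t ∈ K) {Φ : E → F}
    (hΦ : Continuous Φ) (h0 : Tendsto (fun t => Φ (z t)) atTop (𝓝 0)) (S : Set E)
    (hS : ∀ p, Φ p = 0 → p ∈ S) : Tendsto (fun t => Metric.infDist (z t) S) atTop (𝓝 0) := by
  rw [Metric.tendsto_atTop]
  intro ε hε
  have hK2 : IsCompact (K ∩ {p | ε ≤ Metric.infDist p S}) :=
    hK.inter_right (isClosed_le continuous_const (Metric.continuous_infDist_pt S))
  have key : ∃ η > 0, ∀ p ∈ K ∩ {p | ε ≤ Metric.infDist p S}, η ≤ ‖Φ p‖ := by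
    rcases (K ∩ {p | ε ≤ Metric.infDist p S}).eq_empty_or_nonempty with he | hne
    · exact ⟨1, one_pos, by rw [he]; simp⟩
    · obtain ⟨p, hp, hmin⟩ := hK2.exists_isMinOn hne (hΦ.norm.continuousOn)
      refine ⟨‖Φ p‖, ?_, fun q hq => hmin hq⟩
      rw [gt_iff_lt, norm_pos_iff]
      intro hp0
      have := hp.2
      simp only [Set.mem_ofPred_eq, Metric.infDist_zero_of_mem (hS p hp0)] at this
      linarith
  obtain ⟨η, hη, hk⟩ := key
  obtain ⟨T, hT⟩ := (Metric.tendsto_atTop.1 h0) η hη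
  refine ⟨max T 0, fun t ht => ?_⟩
  have := hT t ((le_max_left _ _).trans ht)
  rw [dist_zero_right] at this
  rw [Real.dist_eq, sub_zero, abs_of_nonneg Metric.infDist_nonneg]
  by_contra hcon
  have := hk (z t) ⟨hz t ((le_max_right _ _).trans ht), not_lt.1 hcon⟩
  linarith

end aux2

section aux3
open Topology

lemma S_bound {a b φ : ℝ} (h1 : a < φ) (h2 : φ < b) :
    ∃ δ > 0, ∃ C ≥ 0, ∀ s, δ * |s| - C ≤ Qf a b (-s) + φ * s := by
  have hd : 0 < min (φ - a) (b - φ) := lt_min (by linarith) (by linarith)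
  set δ := min (φ - a) (b - φ) with hδ
  have d1 : δ ≤ φ - a := min_le_left _ _
  have d2 : δ ≤ b - φ := min_le_right _ _
  refine ⟨δ, hd, (φ - δ) ^ 2 / 2 + (φ + δ) ^ 2 / 2, by positivity, fun s => ?_⟩
  have q1 := Qf_ge (h1.trans h2) (-s) (φ - δ) (by linarith) (by linarith)
  have q2 := Qf_ge (h1.trans h2) (-s) (φ + δ) (by linarith) (by linarith)
  rcases abs_cases s with ⟨h, _⟩ | ⟨h, _⟩ <;> rw [h] <;>
    nlinarith [sq_nonneg (φ - δ), sq_nonneg (φ + δ)]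

lemma conv1 {g g' : ℝ → ℝ} (hd : ∀ s, HasDerivAt g (g' s) s) (hm : Monotone g')
    (h0 : g' 0 = 0) {r : ℝ} (hr : 0 ≤ r) : g 0 + g' 1 * (r - 1) ≤ g r := by
  have hmono : MonotoneOn g (Set.Ici 0) := by
    apply monotoneOn_of_hasDerivWithinAt_nonneg (f' := g') (convex_Ici 0)
    · exact fun x _ => (hd x).continuousAt.continuousWithinAt
    · intro x hx; exact (hd x).hasDerivWithinAt
    · intro x hx; rw [interior_Ici] at hx; rw [← h0]; exact hm (le_of_lt hx)
  have h1 : 0 ≤ g' 1 := by rw [← h0]; exact hm zero_le_one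
  rcases le_or_gt r 1 with h | h
  · have := hmono (Set.mem_Ici.2 le_rfl) (Set.mem_Ici.2 hr) hr
    nlinarith
  · have a1 := hmono (Set.mem_Ici.2 le_rfl) (Set.mem_Ici.2 zero_le_one) zero_le_one
    obtain ⟨c, hc, hc2⟩ := exists_hasDerivAt_eq_slope g g' h
      (fun x _ => (hd x).continuousAt.continuousWithinAt) (fun x _ => hd x)
    have hge : g' 1 ≤ g' c := hm hc.1.le
    rw [hc2, le_div_iff₀ (by linarith)] at hge
    linarith

lemma gradH_contDiff {n : ℕ} {H : (Fin n → ℝ) → ℝ} {gradH : (Fin n → ℝ) → (Fin n → ℝ)}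
    (hH : ContDiff ℝ 2 H) (hgradH : ∀ x v, fderiv ℝ H x v = ∑ i, gradH x i * v i) :
    ContDiff ℝ 1 gradH := by
  rw [contDiff_pi]
  intro i
  have : (fun x => gradH x i) = fun x => fderiv ℝ H x (Pi.single i 1) := by
    ext x; rw [hgradH]; simp [Pi.single_apply]
  rw [this]
  exact (hH.fderiv_right (m := 1) (by norm_num)).clm_apply contDiff_const

lemma coercive {n : ℕ} {H : (Fin n → ℝ) → ℝ} {gradH : (Fin n → ℝ) → (Fin n → ℝ)}
    (hH : ContDiff ℝ 2 H) (hgradH : ∀ x v, fderiv ℝ H x v = ∑ i, gradH x i * v i)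
    (hHess : ∀ x v, v ≠ 0 → 0 < ∑ i, v i * ((fderiv ℝ gradH x) v) i)
    (xs : Fin n → ℝ) (α : ℝ) (hxs : gradH xs = fun _ => α) :
    ∃ μ > 0, ∀ x, μ * ‖x - xs‖ - μ ≤ H x - H xs - α * ∑ i, (x i - xs i) := by
  have hg1 := gradH_contDiff hH hgradH
  have hgd : Differentiable ℝ gradH := hg1.differentiable (by norm_num)
  have hHd : Differentiable ℝ H := hH.differentiable (by norm_num)
  -- one-dimensional restriction
  have line : ∀ (d : Fin n → ℝ) (s : ℝ), HasDerivAt (fun s : ℝ => xs + s • d) d s := by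
    intro d s
    simpa using ((hasDerivAt_id s).smul_const d).const_add xs
  have hd1 : ∀ (d : Fin n → ℝ) (s : ℝ),
      HasDerivAt (fun s : ℝ => H (xs + s • d) - α * (s * ∑ i, d i))
        (∑ i, gradH (xs + s • d) i * d i - α * ∑ i, d i) s := by
    intro d s
    have h1 := (hHd (xs + s • d)).hasFDerivAt.comp_hasDerivAt s (line d s)
    rw [hgradH] at h1
    have h2 := (((hasDerivAt_id s).mul_const (∑ i, d i)).const_mul α)
    simpa [Function.comp_def] using h1.fun_sub h2
  have hd2 : ∀ (d : Fin n → ℝ) (s : ℝ),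
      HasDerivAt (fun s : ℝ => ∑ i, gradH (xs + s • d) i * d i - α * ∑ i, d i)
        (∑ i, d i * (fderiv ℝ gradH (xs + s • d) d) i) s := by
    intro d s
    have h1 := (hgd (xs + s • d)).hasFDerivAt.comp_hasDerivAt s (line d s)
    have h2 := hasDerivAt_pi.1 h1
    have h3 := HasDerivAt.fun_sum (u := Finset.univ) (fun i _ => (h2 i).mul_const (d i))
    refine (h3.sub_const (α * ∑ i, d i)).congr_deriv ?_
    exact Finset.sum_congr rfl fun i _ => mul_comm _ _
  have hmono : ∀ d : Fin n → ℝ, d ≠ 0 →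
      StrictMono (fun s : ℝ => ∑ i, gradH (xs + s • d) i * d i - α * ∑ i, d i) := fun d hd =>
    strictMono_of_hasDerivAt_pos (hd2 d) (fun s => hHess _ d hd)
  have hzero : ∀ d : Fin n → ℝ, 
      ∑ i, gradH (xs + (0:ℝ) • d) i * d i - α * ∑ i, d i = 0 := by
    intro d; simp [hxs, Finset.mul_sum]
  have hμ : ∃ μ > 0, ∀ d ∈ Metric.sphere (0 : Fin n → ℝ) 1,
      μ ≤ ∑ i, gradH (xs + (1:ℝ) • d) i * d i - α * ∑ i, d i := by
    rcases (Metric.sphere (0 : Fin n → ℝ) 1).eq_empty_or_nonempty with he | hne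
    · exact ⟨1, one_pos, by rw [he]; simp⟩
    · have hgc := hg1.continuous
      obtain ⟨d, hd, hmin⟩ := (isCompact_sphere (0 : Fin n → ℝ) 1).exists_isMinOn hne
        (f := fun d => ∑ i, gradH (xs + (1:ℝ) • d) i * d i - α * ∑ i, d i)
        (Continuous.continuousOn (by fun_prop))
      refine ⟨_, ?_, fun q hq => hmin hq⟩
      have hd0 : d ≠ 0 := by
        rintro rfl; simp at hd
      have := hmono d hd0 (zero_lt_one)
      simp only [hzero] at this
      exact this
  obtain ⟨μ, hμ, hb⟩ := hμ
  refine ⟨μ, hμ, fun x => ?_⟩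
  by_cases hx : x = xs
  · subst hx; simp [hμ.le]
  have hr : 0 < ‖x - xs‖ := norm_pos_iff.2 (sub_ne_zero.2 hx)
  set r := ‖x - xs‖ with hrdef
  set d := r⁻¹ • (x - xs) with hddef
  have hdn : d ∈ Metric.sphere (0 : Fin n → ℝ) 1 := by
    rw [mem_sphere_zero_iff_norm, hddef, norm_smul, norm_inv, Real.norm_of_nonneg hr.le, ← hrdef,
      inv_mul_cancel₀ hr.ne']
  have hd0 : d ≠ 0 := by
    intro h; rw [h] at hdn; simp at hdn
  have hrd : r • d = x - xs := by rw [hddef, smul_inv_smul₀ hr.ne']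
  have h1 := conv1 (hd1 d) (hmono d hd0).monotone (hzero d) hr.le
  have h2 := hb d hdn
  have hsum : r * ∑ i, d i = ∑ i, (x i - xs i) := by
    rw [Finset.mul_sum]; refine Finset.sum_congr rfl fun i _ => ?_
    have := congrFun hrd i; simpa using this
  simp only [hrd, hsum, zero_smul, add_zero, zero_mul, mul_zero, sub_zero, add_sub_cancel] at h1
  -- μ (r-1) ≤ ...
  rcases le_or_gt r 1 with h | h
  · have hm0 : MonotoneOn (fun s : ℝ => H (xs + s • d) - α * (s * ∑ i, d i)) (Set.Ici 0) := by
      apply monotoneOn_of_hasDerivWithinAt_nonneg (convex_Ici 0)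
      · exact fun x _ => (hd1 d x).continuousAt.continuousWithinAt
      · intro x hx; exact (hd1 d x).hasDerivWithinAt
      · intro x hx; rw [interior_Ici] at hx; rw [← hzero d]; exact (hmono d hd0).monotone (le_of_lt hx)
    have h3 := hm0 (Set.mem_Ici.2 le_rfl) (Set.mem_Ici.2 hr.le) hr.le
    simp only [hrd, hsum, zero_smul, add_zero, zero_mul, mul_zero, sub_zero, add_sub_cancel] at h3
    nlinarith
  · have := mul_le_mul_of_nonneg_right h2 (by linarith : 0 ≤ r - 1)
    linarith

lemma flow_exists (n m : ℕ) (tl hd : Fin m → Fin n) (hloop : ∀ e, tl e ≠ hd e)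
    (B : Matrix (Fin n) (Fin m) ℝ)
    (hB : ∀ i j, B i j = if hd j = i then 1 else if tl j = i then -1 else 0)
    (um up : Fin m → ℝ) (k : ℕ) (T : Fin m → ℕ) (hT1 : ∀ e, 0 < T e)
    (hsplit : ∃ (vl vu : (Σ e : Fin m, Fin (T e)) → ℝ),
      (∀ e (j : Fin (T e)), vl ⟨e, j⟩ = if (j : ℕ) = 0 then um e else 0) ∧
      (∀ p : Σ e : Fin m, Fin (T e), vl p < vu p) ∧
      (∀ e (j : Fin (T e)), 0 < (j : ℕ) → 0 < vu ⟨e, j⟩) ∧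
      (∀ e : Fin m, ∑ j : Fin (T e), vu ⟨e, j⟩ = up e) ∧
      ∃ (lenC : Fin k → ℕ)
        (vC : (j : Fin k) → Fin (lenC j + 1) → Fin n)
        (fC : (j : Fin k) → Fin (lenC j + 1) → (Σ e : Fin m, Fin (T e))),
        IsDirCycleFamily (fun p => tl p.1) (fun p => hd p.1) lenC vC fC ∧
        Function.Bijective
          (fun q : (Σ j : Fin k, Fin (lenC j + 1)) => fC q.1 q.2) ∧
        ∀ j : Fin k,
          (interior (⋂ i : Fin (lenC j + 1),
            Set.Icc (vl (fC j i)) (vu (fC j i)))).Nonempty) :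
    ∃ φ : Fin m → ℝ, B.mulVec φ = 0 ∧ ∀ e, um e < φ e ∧ φ e < up e := by
  obtain ⟨vl, vu, hvl, -, -, hvu, lenC, vC, fC, ⟨-, -, hcyc⟩, hbij, hint⟩ := hsplit
  choose c hc using hint
  have hc' : ∀ j i, vl (fC j i) < c j ∧ c j < vu (fC j i) := by
    intro j i
    have := interior_mono (Set.iInter_subset _ i) (hc j)
    rw [interior_Icc] at this
    exact this
  let ψ := Equiv.ofBijective _ hbij
  let w : (Σ e : Fin m, Fin (T e)) → ℝ := fun p => c (ψ.symm p).1
  have hw : ∀ p, vl p < w p ∧ w p < vu p := by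
    intro p
    have := hc' (ψ.symm p).1 (ψ.symm p).2
    have e : fC (ψ.symm p).1 (ψ.symm p).2 = p := ψ.apply_symm_apply p
    rw [e] at this
    exact this
  refine ⟨fun e => ∑ j : Fin (T e), w ⟨e, j⟩, ?_, fun e => ⟨?_, ?_⟩⟩
  · ext i
    have hBd : ∀ e, B i e = (if hd e = i then (1:ℝ) else 0) - (if tl e = i then (1:ℝ) else 0) := by
      intro e; rw [hB]
      by_cases h1 : hd e = i
      · have : tl e ≠ i := fun h => hloop e (h.trans h1.symm)
        simp [h1, this]
      · simp [h1]
        split_ifs <;> simp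
    simp only [Matrix.mulVec, dotProduct, Pi.zero_apply, Finset.mul_sum]
    rw [← Fintype.sum_sigma' (f := fun e (j : Fin (T e)) => B i e * w ⟨e, j⟩)]
    have : ∑ p : (Σ e : Fin m, Fin (T e)), B i p.1 * w ⟨p.1, p.2⟩ =
        ∑ q : (Σ j : Fin k, Fin (lenC j + 1)), B i (fC q.1 q.2).1 * c q.1 := by
      rw [← ψ.sum_comp]
      refine Finset.sum_congr rfl fun q _ => ?_
      have e2 : w (ψ q) = c q.1 := by simp [w]
      rw [← e2]; rfl
    rw [this, Fintype.sum_sigma]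
    refine Finset.sum_eq_zero fun j _ => ?_
    simp only
    rw [← Finset.sum_mul]
    simp only [hBd, (hcyc j _).1, (hcyc j _).2, Finset.sum_sub_distrib]
    have : ∑ x : Fin (lenC j + 1), (if vC j (x + 1) = i then (1:ℝ) else 0) =
        ∑ x : Fin (lenC j + 1), (if vC j x = i then (1:ℝ) else 0) :=
      Equiv.sum_comp (Equiv.addRight (1 : Fin (lenC j + 1))) (fun x => if vC j x = i then (1:ℝ) else 0)
    rw [this]; simp
  · have hs : ∑ j : Fin (T e), vl ⟨e, j⟩ = um e := by
      rw [Finset.sum_eq_single (⟨0, hT1 e⟩ : Fin (T e))]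
      · simp [hvl]
      · intro j _ hj
        have : (j : ℕ) ≠ 0 := fun h => hj (Fin.ext h)
        simp [hvl, this]
      · simp
    calc um e = _ := hs.symm
      _ < _ := Finset.sum_lt_sum_of_nonempty ⟨⟨0, hT1 e⟩, Finset.mem_univ _⟩ fun j _ => (hw _).1
  · rw [← hvu e]
    exact Finset.sum_lt_sum_of_nonempty ⟨⟨0, hT1 e⟩, Finset.mem_univ _⟩ fun j _ => (hw _).2

end aux3

section aux4
open Topology

lemma SV.eval {ι : Type*} [Fintype ι] {f : ℝ → ι → ℝ} (h : SV f) (i : ι) :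
    SV (fun t => f t i) := by
  intro L hL ε hε
  obtain ⟨T, hT, h1⟩ := h L hL ε hε
  exact ⟨T, hT, fun t ht s hs hsL => (norm_le_pi_norm (f (t+s) - f t) i).trans (h1 t ht s hs hsL)⟩

lemma SV.of_Th {a b : ℝ} {w : ℝ → ℝ} (hw : ∀ t, a ≤ w t ∧ w t ≤ b)
    (h : SV (fun t => Th a b (w t))) : SV w := by
  intro L hL ε hε
  obtain ⟨T, hT, h1⟩ := h L hL (ε ^ 3 / 6) (by positivity)
  refine ⟨T, hT, fun t ht s hs hsL => ?_⟩
  have h2 := h1 t ht s hs hsL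
  have h3 := Th_abs (hw t).1 (hw t).2 (hw (t+s)).2 (hw (t+s)).1
  rw [Real.norm_eq_abs] at h2 ⊢
  have h4 : |w (t+s) - w t| ^ 3 ≤ ε ^ 3 := by linarith
  exact le_of_pow_le_pow_left₀ (by norm_num) hε.le h4

lemma lip_unif {E : Type*} [NormedAddCommGroup E] [NormedSpace ℝ E] {z : ℝ → E} {F : E → E}
    {K : Set E} (hK : IsCompact K) (hz : ∀ t, 0 ≤ t → z t ∈ K) (hF : Continuous F)
    (hd : ∀ t, 0 ≤ t → HasDerivAt z (F (z t)) t) {R : E → ℝ} (hR : Continuous R) :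
    ∀ ε > 0, ∃ δ > 0, ∀ t s, 0 ≤ t → t ≤ s → s ≤ t + δ → |R (z s) - R (z t)| ≤ ε := by
  intro ε hε
  obtain ⟨C, hC⟩ := hK.exists_bound_of_continuousOn hF.continuousOn
  have hu := hK.uniformContinuousOn_of_continuous hR.continuousOn
  obtain ⟨δ, hδ, h⟩ := Metric.uniformContinuousOn_iff.1 hu ε hε
  have hC0 : 0 ≤ C := (norm_nonneg _).trans (hC _ (hz 0 le_rfl))
  refine ⟨δ / (C + 1), by positivity, fun t s ht hts hs => ?_⟩
  have hb := Convex.norm_image_sub_le_of_norm_hasDerivWithin_le (f := z) (f' := fun t => F (z t))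
    (C := C) (s := Set.Ici 0) (x := t) (y := s)
    (fun x hx => (hd x hx).hasDerivWithinAt)
    (fun x hx => hC _ (hz x hx)) (convex_Ici _) ht (Set.mem_Ici.2 (ht.trans hts))
  rw [Real.norm_of_nonneg (sub_nonneg.2 hts)] at hb
  have h1 : (C + 1) * (s - t) ≤ δ := by
    have : s - t ≤ δ / (C + 1) := by linarith
    rw [le_div_iff₀ (by linarith)] at this; linarith
  have h2 : dist (z s) (z t) < δ := by
    rw [dist_eq_norm]
    rcases hts.eq_or_lt with e | e
    · subst e; simpa using hδ
    · nlinarith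
  have := h _ (hz s (ht.trans hts)) _ (hz t ht) h2
  rw [Real.dist_eq] at this
  exact this.le

lemma satVec_cont {m : ℕ} {um up : Fin m → ℝ} (h : ∀ i, um i < up i) :
    Continuous (fun x : Fin m → ℝ => satVec x um up) :=
  continuous_pi fun i => (sat_cont (h i)).comp (continuous_apply i)

lemma main_conv {n m : ℕ} {tl hd : Fin m → Fin n} (hloop : ∀ e, tl e ≠ hd e)
    (hstrong : ∀ i j : Fin n,
      Relation.ReflTransGen (fun a b => ∃ e, tl e = a ∧ hd e = b) i j)
    (B : Matrix (Fin n) (Fin m) ℝ)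
    (hB : ∀ i j, B i j = if hd j = i then 1 else if tl j = i then -1 else 0)
    {H : (Fin n → ℝ) → ℝ} {gradH : (Fin n → ℝ) → (Fin n → ℝ)}
    (hH : ContDiff ℝ 2 H)
    (hgradH : ∀ x v, fderiv ℝ H x v = ∑ i, gradH x i * v i)
    (hHess : ∀ x v, v ≠ 0 → 0 < ∑ i, v i * ((fderiv ℝ gradH x) v) i)
    (um up φ : Fin m → ℝ) (hφ0 : B.mulVec φ = 0) (hφ : ∀ e, um e < φ e ∧ φ e < up e)
    (x : ℝ → (Fin n → ℝ)) (xc : ℝ → (Fin m → ℝ))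
    (htraj : ∀ t : ℝ, 0 ≤ t →
        HasDerivAt x
          (B.mulVec (satVec (-(Bᵀ.mulVec (gradH (x t))) - xc t) um up)) t ∧
        HasDerivAt xc (Bᵀ.mulVec (gradH (x t))) t) :
      Tendsto (fun t => Metric.infDist (x t, xc t)
          {p : (Fin n → ℝ) × (Fin m → ℝ) |
            (∃ α : ℝ, gradH p.1 = fun _ => α) ∧
            B.mulVec (satVec (-p.2) um up) = 0})
        atTop (nhds 0) := by
  have hab : ∀ e, um e < up e := fun e => (hφ e).1.trans (hφ e).2
  by_cases hcrit : ∃ xs, ∃ α : ℝ, gradH xs = fun _ => α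
  swap
  · have : {p : (Fin n → ℝ) × (Fin m → ℝ) |
            (∃ α : ℝ, gradH p.1 = fun _ => α) ∧
            B.mulVec (satVec (-p.2) um up) = 0} = ∅ := by
      ext p
      simp only [Set.mem_ofPred_eq, Set.mem_empty_iff_false, iff_false]
      rintro ⟨⟨α, h⟩, -⟩
      exact hcrit ⟨p.1, α, h⟩
    rw [this]; simp only [Metric.infDist_empty]; exact tendsto_const_nhds
  obtain ⟨xs, α, hxs⟩ := hcrit
  obtain ⟨μ, hμ, hco⟩ := coercive hH hgradH hHess xs α hxs
  choose δ hδ C hC hS using fun e => S_bound (hφ e).1 (hφ e).2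
  have hgc : Continuous gradH := (gradH_contDiff hH hgradH).continuous
  have hHd : Differentiable ℝ H := hH.differentiable (by norm_num)
  let Y : (Fin n → ℝ) → (Fin m → ℝ) := fun x => Bᵀ.mulVec (gradH x)
  have hYc : Continuous Y := continuous_const.matrix_mulVec hgc
  have hsc := satVec_cont hab
  have hBd : ∀ i e, B i e = (if hd e = i then (1:ℝ) else 0) - (if tl e = i then (1:ℝ) else 0) := by
    intro i e; rw [hB]
    by_cases h1 : hd e = i
    · have : tl e ≠ i := fun h => hloop e (h.trans h1.symm)
      simp [h1, this]
    · simp [h1]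
      split_ifs <;> simp
  have hY : ∀ x e, Y x e = gradH x (hd e) - gradH x (tl e) := by
    intro x e
    simp [Y, Matrix.mulVec, dotProduct, hBd, sub_mul, Finset.sum_sub_distrib]
  have hcol : ∀ w : Fin m → ℝ, ∑ i, B.mulVec w i = 0 := by
    intro w
    simp only [Matrix.mulVec, dotProduct]
    rw [Finset.sum_comm]
    refine Finset.sum_eq_zero fun e _ => ?_
    rw [← Finset.sum_mul]
    simp [hBd, Finset.sum_sub_distrib]
  have hadj : ∀ (x : Fin n → ℝ) (w : Fin m → ℝ),
      ∑ i, gradH x i * B.mulVec w i = ∑ e, Y x e * w e := by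
    intro x w
    change gradH x ⬝ᵥ B *ᵥ w = (Bᵀ *ᵥ gradH x) ⬝ᵥ w
    rw [Matrix.dotProduct_mulVec, Matrix.mulVec_transpose]
  have hφY : ∀ x, ∑ e, Y x e * φ e = 0 := by
    intro x; rw [← hadj, hφ0]; simp
  -- vector field
  let F : (Fin n → ℝ) × (Fin m → ℝ) → (Fin n → ℝ) × (Fin m → ℝ) := fun p =>
    (B.mulVec (satVec (-(Y p.1) - p.2) um up), Y p.1)
  have hFc : Continuous F := by
    refine Continuous.prodMk (continuous_const.matrix_mulVec (hsc.comp ?_)) (hYc.comp continuous_fst)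
    exact ((hYc.comp continuous_fst).neg).sub continuous_snd
  let Δ : (Fin n → ℝ) × (Fin m → ℝ) → Fin m → ℝ := fun p e =>
    sat (-(Y p.1 e) - p.2 e) (um e) (up e) - sat (-(p.2 e)) (um e) (up e)
  have hΔc : Continuous Δ := by
    refine continuous_pi fun e => Continuous.sub ((sat_cont (hab e)).comp ?_)
      ((sat_cont (hab e)).comp ?_)
    · exact (((continuous_apply e).comp (hYc.comp continuous_fst)).neg).sub
        ((continuous_apply e).comp continuous_snd)
    · exact ((continuous_apply e).comp continuous_snd).neg
  let R : (Fin n → ℝ) × (Fin m → ℝ) → ℝ := fun p => ∑ e, Y p.1 e * Δ p e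
  have hRc : Continuous R := continuous_finsetSum _ fun e _ =>
    ((continuous_apply e).comp (hYc.comp continuous_fst)).mul ((continuous_apply e).comp hΔc)
  have hterm : ∀ p e, Y p.1 e * Δ p e ≤ -(Δ p e) ^ 2 := fun p e => sat_diss (hab e) _ _
  have hterm0 : ∀ p e, Y p.1 e * Δ p e ≤ 0 := fun p e => by
    have := hterm p e; nlinarith [sq_nonneg (Δ p e)]
  have hR0 : ∀ p, R p ≤ 0 := fun p => Finset.sum_nonpos fun e _ => hterm0 p e
  let z : ℝ → (Fin n → ℝ) × (Fin m → ℝ) := fun t => (x t, xc t)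
  have hz : ∀ t, 0 ≤ t → HasDerivAt z (F (z t)) t := fun t ht =>
    (htraj t ht).1.prodMk (htraj t ht).2
  -- Lyapunov function
  let V : ℝ → ℝ := fun t => (H (x t) - H xs - α * ∑ i, (x t i - xs i)) +
    ∑ e, (Qf (um e) (up e) (-(xc t e)) + φ e * xc t e)
  have hxcd : ∀ t, 0 ≤ t → ∀ e, HasDerivAt (fun t => xc t e) (Y (x t) e) t := fun t ht =>
    hasDerivAt_pi.1 (htraj t ht).2
  have hxd : ∀ t, 0 ≤ t → ∀ i, HasDerivAt (fun t => x t i)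
      (B.mulVec (satVec (-(Y (x t)) - xc t) um up) i) t := fun t ht =>
    hasDerivAt_pi.1 (htraj t ht).1
  have hVd : ∀ t, 0 ≤ t → HasDerivAt V (R (z t)) t := by
    intro t ht
    have h1 := (hHd (x t)).hasFDerivAt.comp_hasDerivAt t (htraj t ht).1
    rw [hgradH, hadj] at h1
    have h2 := HasDerivAt.fun_sum (u := Finset.univ)
      (fun i _ => (hxd t ht i).sub_const (xs i))
    rw [hcol] at h2
    have h3 := HasDerivAt.fun_sum (u := Finset.univ) (fun e _ =>
      ((Qf_deriv (hab e) (-(xc t e))).comp t (hxcd t ht e).fun_neg).fun_add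
        ((hxcd t ht e).const_mul (φ e)))
    have h4 := ((h1.sub_const (H xs)).fun_sub (h2.const_mul α)).fun_add h3
    refine h4.congr_deriv ?_
    rw [mul_zero, sub_zero, ← Finset.sum_add_distrib]
    have : R (z t) = R (z t) + ∑ e, Y (x t) e * φ e := by rw [hφY, add_zero]
    rw [this, ← Finset.sum_add_distrib]
    refine Finset.sum_congr rfl fun e _ => ?_
    simp only [Δ, z, satVec, Pi.sub_apply, Pi.neg_apply]
    ring
  have hVanti : AntitoneOn V (Set.Ici 0) := by
    apply antitoneOn_of_hasDerivWithinAt_nonpos (f' := fun t => R (z t)) (convex_Ici 0)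
    · exact fun x hx => (hVd x hx).continuousAt.continuousWithinAt
    · intro x hx; rw [interior_Ici] at hx; exact (hVd x (le_of_lt hx)).hasDerivWithinAt
    · intro x hx; exact hR0 _
  have hV0 : ∀ t, 0 ≤ t → V t ≤ V 0 := fun t ht =>
    hVanti (Set.mem_Ici.2 le_rfl) (Set.mem_Ici.2 ht) ht
  have hSC : ∀ t e, -(C e) ≤ Qf (um e) (up e) (-(xc t e)) + φ e * xc t e := by
    intro t e
    have := hS e (xc t e)
    have h2 := mul_nonneg (hδ e).le (abs_nonneg (xc t e))
    linarith
  have hsumC : ∀ t, -(∑ e, C e) ≤ ∑ e, (Qf (um e) (up e) (-(xc t e)) + φ e * xc t e) := by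
    intro t; rw [← Finset.sum_neg_distrib]; exact Finset.sum_le_sum fun e _ => hSC t e
  have hVlow : ∀ t, -μ - ∑ e, C e ≤ V t := by
    intro t
    have h1 := hco (x t)
    have h2 := hsumC t
    have h3 := mul_nonneg hμ.le (norm_nonneg (x t - xs))
    simp only [V]; linarith
  have hxb : ∀ t, 0 ≤ t → ‖x t - xs‖ ≤ (V 0 + μ + ∑ e, C e) / μ := by
    intro t ht
    rw [le_div_iff₀ hμ]
    have h1 := hco (x t)
    have h2 := hsumC t
    have h3 := hV0 t ht
    simp only [V] at h3 ⊢; linarith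
  have hxcb : ∀ t, 0 ≤ t → ∀ e, |xc t e| ≤ (V 0 + μ + ∑ e, C e) / δ e := by
    intro t ht e
    rw [le_div_iff₀ (hδ e)]
    have h1 := hco (x t)
    have h3 := hV0 t ht
    have h4 := mul_nonneg hμ.le (norm_nonneg (x t - xs))
    have h5 := Finset.single_le_sum (f := fun e => 
      (Qf (um e) (up e) (-(xc t e)) + φ e * xc t e) + C e) (s := Finset.univ)
      (fun e _ => by have := hSC t e; linarith) (Finset.mem_univ e)
    rw [Finset.sum_add_distrib] at h5
    have h6 := hS e (xc t e)
    simp only [V] at h3 ⊢; linarith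
  let K : Set ((Fin n → ℝ) × (Fin m → ℝ)) :=
    Metric.closedBall xs ((V 0 + μ + ∑ e, C e) / μ) ×ˢ
      Set.pi Set.univ (fun e => Set.Icc (-((V 0 + μ + ∑ e, C e) / δ e))
        ((V 0 + μ + ∑ e, C e) / δ e))
  have hK : IsCompact K := (isCompact_closedBall _ _).prod (isCompact_univ_pi fun e => isCompact_Icc)
  have hzK : ∀ t, 0 ≤ t → z t ∈ K := by
    intro t ht
    refine ⟨?_, fun e _ => ?_⟩
    · rw [Metric.mem_closedBall, dist_eq_norm]; exact hxb t ht
    · exact abs_le.1 (hxcb t ht e)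
  -- dissipation tends to zero
  have hR : Tendsto (fun t => R (z t)) atTop (𝓝 0) :=
    barbalat hVd (fun t _ => hVlow t) (fun t _ => hR0 _) (lip_unif hK hzK hFc hz hRc)
  have hT0 : ∀ e, Tendsto (fun t => |Y (x t) e * Δ (z t) e|) atTop (𝓝 0) := by
    intro e
    have h1 : Tendsto (fun t => -R (z t)) atTop (𝓝 0) := by simpa using hR.neg
    refine squeeze_zero (fun t => abs_nonneg _) (fun t => ?_) h1
    rw [abs_of_nonpos (hterm0 (z t) e)]
    simp only [R]
    rw [← Finset.sum_neg_distrib]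
    exact Finset.single_le_sum (f := fun e => -(Y (z t).1 e * Δ (z t) e)) (s := Finset.univ)
      (fun e _ => neg_nonneg.2 (hterm0 (z t) e)) (Finset.mem_univ e)
  have hsq : ∀ e, Tendsto (fun t => √|Y (x t) e * Δ (z t) e|) atTop (𝓝 0) := by
    intro e
    have h1 := (Real.continuous_sqrt.tendsto 0).comp (hT0 e)
    rw [Real.sqrt_zero] at h1
    exact h1
  have hΔ0 : Tendsto (fun t => Δ (z t)) atTop (𝓝 0) := by
    rw [tendsto_pi_nhds]
    intro e
    refine squeeze_zero_norm (fun t => ?_) (hsq e)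
    rw [Real.norm_eq_abs]
    apply Real.abs_le_sqrt
    rw [abs_of_nonpos (hterm0 (z t) e)]
    have := hterm (z t) e
    simp only [z] at this ⊢; linarith
  -- W is slowly varying
  let W : ℝ → Fin m → ℝ := fun t => satVec (-(xc t)) um up
  have hWSV : SV W := by
    apply SV.pi
    intro e
    refine SV.of_Th (a := um e) (b := up e) (fun t => sat_mem (hab e) _) ?_
    refine SV.of_deriv (f' := fun t => ((W t e - um e) * (up e - W t e)) * -(Y (x t) e))
      (fun t ht => ?_) ?_
    · exact (Th_sat_deriv (hab e) (-(xc t e))).comp t (hxcd t ht e).fun_neg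
    · have hlim : Tendsto (fun t => (up e - um e) * |Y (x t) e * Δ (z t) e| +
          (up e - um e) ^ 2 * √|Y (x t) e * Δ (z t) e|) atTop (𝓝 0) := by
        simpa using ((hT0 e).const_mul (up e - um e)).add ((hsq e).const_mul ((up e - um e) ^ 2))
      refine squeeze_zero_norm (fun t => ?_) hlim
      have := key_bound (hab e) (Y (x t) e) (xc t e)
      rw [Real.norm_eq_abs, mul_neg, abs_neg, mul_comm]
      exact this
  have hBc : Continuous (fun w : Fin m → ℝ => B.mulVec w) :=
    continuous_const.matrix_mulVec continuous_id
  have hBW : SV (fun t => B.mulVec (W t)) :=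
    hWSV.comp (isCompact_univ_pi fun e => isCompact_Icc (a := um e) (b := up e))
      (fun t _ e _ => sat_mem (hab e) _) hBc
  have hdiff : Tendsto (fun t => B.mulVec (satVec (-(Y (x t)) - xc t) um up) - B.mulVec (W t))
      atTop (𝓝 0) := by
    have h1 := (hBc.tendsto 0).comp hΔ0
    rw [Matrix.mulVec_zero] at h1
    refine h1.congr fun t => ?_
    rw [← Matrix.mulVec_sub]; rfl
  have hx'SV : SV (fun t => B.mulVec (satVec (-(Y (x t)) - xc t) um up)) := hBW.congr0 hdiff
  have hx'0 : Tendsto (fun t => B.mulVec (satVec (-(Y (x t)) - xc t) um up)) atTop (𝓝 0) := by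
    rw [tendsto_pi_nhds]
    intro i
    refine SV.tendsto_zero (f := fun t => x t i) (M := (V 0 + μ + ∑ e, C e) / μ + ‖xs‖)
      (fun t ht => hxd t ht i) (fun t ht => ?_) (hx'SV.eval i)
    have h1 := norm_le_pi_norm (x t) i
    have h2 := hxb t ht
    have h3 := norm_le_norm_sub_add (x t) xs
    rw [Real.norm_eq_abs] at h1
    linarith
  have hBW0 : Tendsto (fun t => B.mulVec (W t)) atTop (𝓝 0) := by
    have := hx'0.sub hdiff
    simpa using this
  have hxSV : SV x := SV.of_deriv (fun t ht => (htraj t ht).1) hx'0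
  have hYSV : SV (fun t => Y (x t)) :=
    hxSV.comp (isCompact_closedBall xs ((V 0 + μ + ∑ e, C e) / μ)) (fun t ht => (hzK t ht).1) hYc
  have hY0 : Tendsto (fun t => Y (x t)) atTop (𝓝 0) := by
    rw [tendsto_pi_nhds]
    intro e
    exact SV.tendsto_zero (f := fun t => xc t e) (fun t ht => hxcd t ht e)
      (fun t ht => hxcb t ht e) (hYSV.eval e)
  -- conclusion
  refine infDist_tendsto (z := z) hK hzK
    (Φ := fun p => (Y p.1, B.mulVec (satVec (-p.2) um up))) ?_ (hY0.prodMk_nhds hBW0) _ ?_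
  · exact (hYc.comp continuous_fst).prodMk (hBc.comp (hsc.comp continuous_snd.neg))
  · intro p hp
    rw [Prod.mk_eq_zero] at hp
    refine ⟨?_, hp.2⟩
    have hedge : ∀ e, gradH p.1 (tl e) = gradH p.1 (hd e) := by
      intro e
      have := congrFun hp.1 e
      rw [hY] at this
      simp only [Pi.zero_apply] at this
      linarith
    have hall : ∀ i j, gradH p.1 i = gradH p.1 j := by
      intro i j
      induction hstrong i j with
      | refl => rfl
      | tail _ h ih =>
        obtain ⟨e, h1, h2⟩ := h
        rw [ih, ← h1, ← h2]; exact hedge e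
    rcases isEmpty_or_nonempty (Fin n) with he | ⟨⟨i0⟩⟩
    · exact ⟨0, funext fun i => he.elim i⟩
    · exact ⟨gradH p.1 i0, funext fun i => hall i i0⟩

end aux4

/-- Sufficient condition for consensus of the constrained closed-loop
system ẋ = B sat(−Bᵀ∇H(x) − x_c; u⁻, u⁺), ẋ_c = Bᵀ∇H(x) on a strongly connected
graph compatible with the constraints.  Given a minimal covering family T of directed
cycles, with multiplicities Tᵢ, the augmented graph G̃(T) has edges Σ i, Fin (Tᵢ)
(edge i split into Tᵢ parallel copies with the same tail and head); a splitting of the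
constraint interval [u⁻ᵢ, u⁺ᵢ] into [u⁻ᵢ, b₂], [0, b₃ − b₂], …, [0, u⁺ᵢ − b_{Tᵢ}]
is encoded by lower bounds vl (equal to u⁻ᵢ on the first copy and 0 on the others) and
upper bounds vu (the successive increments, positive from the second copy on, summing
to u⁺ᵢ).  If there is such a splitting and a covering of G̃(T) by k pairwise
edge-disjoint directed cycles such that for each cycle the intersection of the
constraint intervals of its edges has non-empty interior, then every trajectory
converges to E_tot = {(x,x_c) : ∇H(x) = α𝟙, B sat(−x_c; u⁻, u⁺) = 0}. -/
theorem stmt_16 (n m : ℕ) (tl hd : Fin m → Fin n) (hloop : ∀ e, tl e ≠ hd e)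
    (hstrong : ∀ i j : Fin n,
      Relation.ReflTransGen (fun a b => ∃ e, tl e = a ∧ hd e = b) i j)
    (B : Matrix (Fin n) (Fin m) ℝ)
    (hB : ∀ i j, B i j = if hd j = i then 1 else if tl j = i then -1 else 0)
    (H : (Fin n → ℝ) → ℝ) (gradH : (Fin n → ℝ) → (Fin n → ℝ))
    (hH : ContDiff ℝ 2 H)
    (hgradH : ∀ x v, fderiv ℝ H x v = ∑ i, gradH x i * v i)
    -- the Hessian of H is everywhere positive definite
    (hHess : ∀ x v, v ≠ 0 → 0 < ∑ i, v i * ((fderiv ℝ gradH x) v) i)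
    (um up : Fin m → ℝ)
    -- the orientation is compatible with the constraints
    (hcompat : ∀ i, 0 ≤ um i ∧ um i < up i ∧ 0 < up i)
    -- T = (C₁, …, C_k): a family of k directed cycles covering every edge of G …
    (k : ℕ) (lenT : Fin k → ℕ)
    (vT : (j : Fin k) → Fin (lenT j + 1) → Fin n)
    (fT : (j : Fin k) → Fin (lenT j + 1) → Fin m)
    (hT : IsDirCycleFamily tl hd lenT vT fT)
    (hTcov : ∀ e : Fin m, ∃ j i, fT j i = e)
    -- … which is minimal: no family with fewer cycles covers all edges
    (hTmin : ∀ (k' : ℕ) (len' : Fin k' → ℕ)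
        (v' : (j : Fin k') → Fin (len' j + 1) → Fin n)
        (f' : (j : Fin k') → Fin (len' j + 1) → Fin m),
        IsDirCycleFamily tl hd len' v' f' → (∀ e : Fin m, ∃ j i, f' j i = e) →
        k ≤ k')
    -- T e = number of cycles of T containing edge e
    (T : Fin m → ℕ) (hmult : ∀ e, T e = Nat.card {j : Fin k // ∃ i, fT j i = e})
    -- there exists a splitting of the overlapped edges (constraint intervals
    -- [vl, vu] on the augmented graph G̃(T)) and a covering family T̃ of k pairwise
    -- edge-disjoint directed cycles of G̃(T) such that the intersection of the
    -- constraint intervals of the edges of each cycle has non-empty interior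
    (hsplit : ∃ (vl vu : (Σ e : Fin m, Fin (T e)) → ℝ),
      (∀ e (j : Fin (T e)), vl ⟨e, j⟩ = if (j : ℕ) = 0 then um e else 0) ∧
      (∀ p : Σ e : Fin m, Fin (T e), vl p < vu p) ∧
      (∀ e (j : Fin (T e)), 0 < (j : ℕ) → 0 < vu ⟨e, j⟩) ∧
      (∀ e : Fin m, ∑ j : Fin (T e), vu ⟨e, j⟩ = up e) ∧
      ∃ (lenC : Fin k → ℕ)
        (vC : (j : Fin k) → Fin (lenC j + 1) → Fin n)
        (fC : (j : Fin k) → Fin (lenC j + 1) → (Σ e : Fin m, Fin (T e))),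
        IsDirCycleFamily (fun p => tl p.1) (fun p => hd p.1) lenC vC fC ∧
        -- pairwise edge-disjoint and covering every edge of G̃(T)
        Function.Bijective
          (fun q : (Σ j : Fin k, Fin (lenC j + 1)) => fC q.1 q.2) ∧
        -- each cycle's constraint intervals intersect with non-empty interior
        ∀ j : Fin k,
          (interior (⋂ i : Fin (lenC j + 1),
            Set.Icc (vl (fC j i)) (vu (fC j i)))).Nonempty) :
    ∀ (x : ℝ → (Fin n → ℝ)) (xc : ℝ → (Fin m → ℝ)),
      (∀ t : ℝ, 0 ≤ t →
        HasDerivAt x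
          (B.mulVec (satVec (-(Bᵀ.mulVec (gradH (x t))) - xc t) um up)) t ∧
        HasDerivAt xc (Bᵀ.mulVec (gradH (x t))) t) →
      Tendsto (fun t => Metric.infDist (x t, xc t)
          {p : (Fin n → ℝ) × (Fin m → ℝ) |
            (∃ α : ℝ, gradH p.1 = fun _ => α) ∧
            B.mulVec (satVec (-p.2) um up) = 0})
        atTop (nhds 0) := by
  have hT1 : ∀ e, 0 < T e := by
    intro e
    rw [hmult e]
    obtain ⟨j, i, h⟩ := hTcov e
    haveI : Nonempty {j : Fin k // ∃ i, fT j i = e} := ⟨⟨j, i, h⟩⟩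
    exact Nat.card_pos
  obtain ⟨φ, hφ0, hφ⟩ := flow_exists n m tl hd hloop B hB um up k T hT1 hsplit
  intro x xc htraj
  exact main_conv hloop hstrong B hB hH hgradH hHess um up φ hφ0 hφ x xc htraj
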